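/- arXiv:2604.02297 — 4 statements merged into one kernel-verified Lean document; each statement's English description precedes it below -/
import Mathlib

section
/- Let d ≥ 1 be an integer, p ∈ [1,∞) a real number, β > 0 and μ ∈ ℝ, and let f_{β,μ}(x,ξ) = (1 + exp(β(|x|² + |ξ|² − μ)))^{-1} on ℝ^d × ℝ^d. Then ‖∇_x f_{β,μ}‖_{L^p(ℝ^{2d})} = ‖∇_ξ f_{β,μ}‖_{L^p(ℝ^{2d})} = C_{d,p} ‖∇_z f_{β,μ}‖_{L^p(ℝ^{2d})}, where the constant C_{d,p} is given by C_{d,p}^p = ω_d ω_{2d+p} / (ω_{2d} ω_{d+p}) with ω_s := 2 π^{s/2} / Γ(s/2), ∇_x and ∇_ξ denote the partial gradients in the x and ξ variables respectively, and ∇_z f = (∇_x f, ∇_ξ f) the full phase-space gradient. -/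
open MeasureTheory

/-- The classical Fermi–Dirac phase-space distribution on ℝ^d × ℝ^d. -/
noncomputable def fermiDirac (d : ℕ) (β μ : ℝ)
    (x ξ : EuclideanSpace ℝ (Fin d)) : ℝ :=
  (1 + Real.exp (β * (‖x‖ ^ 2 + ‖ξ‖ ^ 2 - μ)))⁻¹

/-- `ω_s := 2 π^{s/2} / Γ(s/2)`. -/
noncomputable def omegaS (s : ℝ) : ℝ := 2 * Real.pi ^ (s / 2) / Real.Gamma (s / 2)

section Polar

variable {V : Type*} [NormedAddCommGroup V] [NormedSpace ℝ V] [FiniteDimensional ℝ V]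
  [MeasurableSpace V] [BorelSpace V] [Nontrivial V] (ν : Measure V) [ν.IsAddHaarMeasure]

/-- Integration in polar coordinates of a positively homogeneous weight times a radial function. -/
lemma integral_homogeneous_mul_radial {p : ℝ} {w : V → ℝ}
    (hw : ∀ r : ℝ, 0 < r → ∀ v, w (r • v) = r ^ p * w v) (g : ℝ → ℝ) :
    ∫ v, w v * g ‖v‖ ∂ν =
      (∫ s : Metric.sphere (0 : V) 1, w s ∂ν.toSphere) *
        ∫ r in Set.Ioi (0 : ℝ), r ^ (Module.finrank ℝ V - 1) * (r ^ p * g r) := by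
  calc
    ∫ v, w v * g ‖v‖ ∂ν = ∫ v : ({(0)}ᶜ : Set V), w v.1 * g ‖v.1‖ ∂(ν.comap (↑)) := by
      rw [integral_subtype_comap (measurableSet_singleton _).compl fun v ↦ w v * g ‖v‖,
        restrict_compl_singleton]
    _ = ∫ q, w q.1 * (q.2.1 ^ p * g q.2)
          ∂ν.toSphere.prod (.volumeIoiPow (Module.finrank ℝ V - 1)) := by
      rw [← ν.measurePreserving_homeomorphUnitSphereProd.integral_comp
        (Homeomorph.measurableEmbedding _)]
      refine integral_congr_ae (.of_forall fun v ↦ ?_)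
      have hv : 0 < ‖v.1‖ := norm_pos_iff.2 v.2
      have h := hw ‖v.1‖ hv (‖v.1‖⁻¹ • v.1)
      rw [smul_inv_smul₀ hv.ne'] at h
      simp only [homeomorphUnitSphereProd_apply_snd_coe, homeomorphUnitSphereProd_apply_fst_coe]
      rw [h]
      ring
    _ = (∫ s : Metric.sphere (0 : V) 1, w s ∂ν.toSphere) *
          ∫ r : Set.Ioi (0 : ℝ), r.1 ^ p * g r ∂.volumeIoiPow (Module.finrank ℝ V - 1) :=
      integral_prod_mul (fun s : Metric.sphere (0 : V) 1 ↦ w s)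
        (fun r : Set.Ioi (0 : ℝ) ↦ r.1 ^ p * g r)
    _ = _ := by
      congr 1
      simp only [Measure.volumeIoiPow, ENNReal.ofReal]
      rw [integral_withDensity_eq_integral_smul,
        integral_subtype_comap measurableSet_Ioi
          fun a ↦ Real.toNNReal (a ^ (Module.finrank ℝ V - 1)) • (a ^ p * g a),
        setIntegral_congr_fun measurableSet_Ioi fun x hx ↦ ?_]
      · rw [NNReal.smul_def, Real.coe_toNNReal _ (pow_nonneg hx.out.le _), smul_eq_mul]
      · exact (measurable_subtype_coe.pow_const _).real_toNNReal

/-- Gaussian integral of a positively homogeneous weight. -/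
lemma integral_homogeneous_mul_exp_neg_norm_sq {p : ℝ} (hp : 0 ≤ p) {w : V → ℝ}
    (hw : ∀ r : ℝ, 0 < r → ∀ v, w (r • v) = r ^ p * w v) :
    ∫ v, w v * Real.exp (-‖v‖ ^ 2) ∂ν =
      (∫ s : Metric.sphere (0 : V) 1, w s ∂ν.toSphere) *
        (Real.Gamma ((Module.finrank ℝ V + p) / 2) / 2) := by
  rw [integral_homogeneous_mul_radial ν hw fun r ↦ Real.exp (-r ^ 2)]
  congr 1
  have hn : 1 ≤ Module.finrank ℝ V := Module.finrank_pos
  have hn' : (1 : ℝ) ≤ Module.finrank ℝ V := by exact_mod_cast hn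
  have h := integral_rpow_mul_exp_neg_rpow (p := 2) (q := Module.finrank ℝ V - 1 + p)
    (by norm_num) (by linarith)
  rw [show (Module.finrank ℝ V - 1 + p + 1 : ℝ) = Module.finrank ℝ V + p by ring] at h
  rw [div_eq_inv_mul, ← one_div, ← h]
  refine setIntegral_congr_fun measurableSet_Ioi fun r hr ↦ ?_
  have hr : 0 < r := hr
  rw [Real.rpow_add hr, ← Real.rpow_natCast r (_ - 1), Nat.cast_sub hn, Nat.cast_one,
    Real.rpow_two, mul_assoc]

/-- Gaussian moments of the norm. -/
lemma integral_norm_rpow_mul_exp_neg_norm_sq {p : ℝ} (hp : 0 ≤ p) :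
    ∫ v, ‖v‖ ^ p * Real.exp (-‖v‖ ^ 2) ∂ν =
      ν.toSphere.real Set.univ * (Real.Gamma ((Module.finrank ℝ V + p) / 2) / 2) := by
  rw [integral_homogeneous_mul_exp_neg_norm_sq ν hp (w := fun v ↦ ‖v‖ ^ p)]
  · simp
  · intro r hr v
    rw [norm_smul, Real.norm_of_nonneg hr.le, Real.mul_rpow hr.le (norm_nonneg v)]

end Polar

section Product

variable {E : Type*} [NormedAddCommGroup E] [InnerProductSpace ℝ E] [FiniteDimensional ℝ E]
  [MeasurableSpace E] [BorelSpace E]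

lemma integral_prod_eq_integral_withLp (F : E × E → ℝ) :
    ∫ z, F z = ∫ v : WithLp 2 (E × E), F (v.fst, v.snd) :=
  ((WithLp.volume_preserving_ofLp E E).integral_comp
    (MeasurableEquiv.toLp 2 (E × E)).symm.measurableEmbedding F).symm

/-- Weighting a radial function on `E × E` by `‖x‖ ^ p` instead of `‖(x, ξ)‖ ^ p` changes its
integral by a factor that does not depend on the function. -/
lemma integral_norm_fst_rpow_mul_radial [Nontrivial E] {p : ℝ} (hp : 0 ≤ p) (g : ℝ → ℝ) :
    ∫ z : E × E, ‖z.1‖ ^ p * g (‖z.1‖ ^ 2 + ‖z.2‖ ^ 2) =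
      Real.Gamma ((Module.finrank ℝ E + p) / 2) * Real.Gamma (Module.finrank ℝ E) /
        (Real.Gamma (Module.finrank ℝ E / 2) * Real.Gamma (Module.finrank ℝ E + p / 2)) *
      ∫ z : E × E, (‖z.1‖ ^ 2 + ‖z.2‖ ^ 2) ^ (p / 2) * g (‖z.1‖ ^ 2 + ‖z.2‖ ^ 2) := by
  set n := (Module.finrank ℝ E : ℝ)
  have hn0 : 0 < n := Nat.cast_pos.2 Module.finrank_pos
  have : Nontrivial (WithLp 2 (E × E)) := (WithLp.equiv 2 (E × E)).nontrivial
  have hnV : (Module.finrank ℝ (WithLp 2 (E × E)) : ℝ) = 2 * n := by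
    rw [(WithLp.linearEquiv 2 ℝ (E × E)).finrank_eq, Module.finrank_prod]; push_cast; ring
  have hw : ∀ r : ℝ, 0 < r → ∀ v : WithLp 2 (E × E),
      ‖(r • v).fst‖ ^ p = r ^ p * ‖v.fst‖ ^ p := fun r hr v ↦ by
    rw [WithLp.smul_fst, norm_smul, Real.norm_of_nonneg hr.le,
      Real.mul_rpow hr.le (norm_nonneg _)]
  have hw' : ∀ r : ℝ, 0 < r → ∀ v : WithLp 2 (E × E), ‖r • v‖ ^ p = r ^ p * ‖v‖ ^ p :=
    fun r hr v ↦ by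
      rw [norm_smul, Real.norm_of_nonneg hr.le, Real.mul_rpow hr.le (norm_nonneg _)]
  have hpow (v : WithLp 2 (E × E)) : (‖v‖ ^ 2) ^ (p / 2) = ‖v‖ ^ p := by
    rw [← Real.rpow_natCast, ← Real.rpow_mul (norm_nonneg _)]; congr 1; push_cast; ring
  have gauss (q : ℝ) (hq : 0 ≤ q) :
      ∫ v : WithLp 2 (E × E), ‖v.fst‖ ^ q * Real.exp (-‖v‖ ^ 2) =
        (∫ x : E, ‖x‖ ^ q * Real.exp (-‖x‖ ^ 2)) *
          ∫ x : E, ‖x‖ ^ (0 : ℝ) * Real.exp (-‖x‖ ^ 2) := by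
    rw [← integral_prod_mul, ← Measure.volume_eq_prod, integral_prod_eq_integral_withLp]
    refine integral_congr_ae (.of_forall fun v ↦ ?_)
    simp only [WithLp.prod_norm_sq_eq_of_L2, Real.rpow_zero, one_mul, neg_add, Real.exp_add]
    ring
  have g1 := gauss p hp
  have g0 := gauss 0 le_rfl
  have g0' := integral_norm_rpow_mul_exp_neg_norm_sq
    (volume : Measure (WithLp 2 (E × E))) (le_refl 0)
  simp only [Real.rpow_zero] at g0 g0'
  rw [g0'] at g0
  rw [integral_homogeneous_mul_exp_neg_norm_sq volume hp hw] at g1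
  have e0 := integral_norm_rpow_mul_exp_neg_norm_sq (volume : Measure E) (le_refl 0)
  have ep := integral_norm_rpow_mul_exp_neg_norm_sq (volume : Measure E) hp
  simp only [Real.rpow_zero] at e0 g1
  rw [e0] at g0 g1
  rw [ep] at g1
  rw [hnV] at g0 g1
  rw [integral_prod_eq_integral_withLp, integral_prod_eq_integral_withLp]
  simp only [← WithLp.prod_norm_sq_eq_of_L2, hpow]
  rw [integral_homogeneous_mul_radial volume hw fun r ↦ g (r ^ 2),
    integral_homogeneous_mul_radial volume hw' fun r ↦ g (r ^ 2), ← mul_assoc]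
  congr 1
  simp only [norm_eq_of_mem_sphere, Real.one_rpow, integral_const, smul_eq_mul, mul_one]
  rw [add_zero, add_zero, mul_div_cancel_left₀ n two_ne_zero] at g0
  rw [show (2 * n + p) / 2 = n + p / 2 by ring, add_zero] at g1
  have p1 : 0 < Real.Gamma n := Real.Gamma_pos_of_pos hn0
  have p2 : 0 < Real.Gamma (n / 2) := Real.Gamma_pos_of_pos (by positivity)
  have p3 : 0 < Real.Gamma (n + p / 2) := Real.Gamma_pos_of_pos (by positivity)
  rw [div_mul_eq_mul_div, eq_div_iff (by positivity)]
  linear_combination 2 * Real.Gamma (n / 2) * g1 - 2 * Real.Gamma ((n + p) / 2) * g0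

end Product

/-- The modulus of the radial profile of the gradient of the Fermi–Dirac distribution,
as a function of `|x|² + |ξ|²`. -/
noncomputable def fermiDiracSlope (β μ t : ℝ) : ℝ :=
  2 * β * Real.exp (β * (t - μ)) / (1 + Real.exp (β * (t - μ))) ^ 2

lemma fermiDiracSlope_nonneg {β : ℝ} (hβ : 0 ≤ β) (μ t : ℝ) : 0 ≤ fermiDiracSlope β μ t := by
  unfold fermiDiracSlope; positivity

lemma fermiDirac_comm (d : ℕ) (β μ : ℝ) (x ξ : EuclideanSpace ℝ (Fin d)) :
    fermiDirac d β μ x ξ = fermiDirac d β μ ξ x := by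
  simp only [fermiDirac, add_comm (‖x‖ ^ 2)]

lemma hasGradientAt_fermiDirac (d : ℕ) (β μ : ℝ) (x ξ : EuclideanSpace ℝ (Fin d)) :
    HasGradientAt (fun x ↦ fermiDirac d β μ x ξ)
      (-fermiDiracSlope β μ (‖x‖ ^ 2 + ‖ξ‖ ^ 2) • x) x := by
  rw [hasGradientAt_iff_hasFDerivAt]
  have h1 : HasFDerivAt (fun y : EuclideanSpace ℝ (Fin d) ↦ ‖y‖ ^ 2) (2 • innerSL ℝ x) x :=
    (hasStrictFDerivAt_norm_sq x).hasFDerivAt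
  have h2 : HasDerivAt (fun t : ℝ ↦ (1 + Real.exp (β * (t + ‖ξ‖ ^ 2 - μ)))⁻¹)
      (-fermiDiracSlope β μ (‖x‖ ^ 2 + ‖ξ‖ ^ 2) / 2) (‖x‖ ^ 2) := by
    have h := (((((hasDerivAt_id (‖x‖ ^ 2)).add_const (‖ξ‖ ^ 2)).sub_const μ).const_mul
      β).exp.const_add 1).fun_inv (by simp only [id]; positivity)
    refine h.congr_deriv ?_
    simp only [id, fermiDiracSlope]
    ring
  refine (h2.comp_hasFDerivAt x h1).congr_fderiv ?_
  ext y
  simp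
  ring

lemma norm_gradient_fermiDirac (d : ℕ) {β : ℝ} (hβ : 0 ≤ β) (μ : ℝ)
    (x ξ : EuclideanSpace ℝ (Fin d)) :
    ‖gradient (fun x ↦ fermiDirac d β μ x ξ) x‖ =
      ‖x‖ * fermiDiracSlope β μ (‖x‖ ^ 2 + ‖ξ‖ ^ 2) := by
  rw [(hasGradientAt_fermiDirac d β μ x ξ).gradient, norm_smul, norm_neg,
    Real.norm_of_nonneg (fermiDiracSlope_nonneg hβ _ _), mul_comm]

lemma norm_gradient_fermiDirac_snd (d : ℕ) {β : ℝ} (hβ : 0 ≤ β) (μ : ℝ)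
    (x ξ : EuclideanSpace ℝ (Fin d)) :
    ‖gradient (fun ξ ↦ fermiDirac d β μ x ξ) ξ‖ =
      ‖ξ‖ * fermiDiracSlope β μ (‖x‖ ^ 2 + ‖ξ‖ ^ 2) := by
  simp only [fermiDirac_comm d β μ x]
  rw [norm_gradient_fermiDirac d hβ, add_comm]

lemma omegaS_ratio {d p : ℝ} (hd : 0 < d) (hp : 0 ≤ p) :
    omegaS d * omegaS (2 * d + p) / (omegaS (2 * d) * omegaS (d + p)) =
      Real.Gamma ((d + p) / 2) * Real.Gamma d / (Real.Gamma (d / 2) * Real.Gamma (d + p / 2)) := by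
  have hpi : Real.pi ^ (d / 2) * Real.pi ^ (d + p / 2) = Real.pi ^ d * Real.pi ^ ((d + p) / 2) := by
    rw [← Real.rpow_add Real.pi_pos, ← Real.rpow_add Real.pi_pos]; congr 1; ring
  unfold omegaS
  rw [show (2 * d + p) / 2 = d + p / 2 by ring, mul_div_cancel_left₀ d two_ne_zero]
  have p1 : 0 < Real.Gamma d := Real.Gamma_pos_of_pos hd
  have p2 : 0 < Real.Gamma (d / 2) := Real.Gamma_pos_of_pos (by positivity)
  have p3 : 0 < Real.Gamma (d + p / 2) := Real.Gamma_pos_of_pos (by positivity)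
  have p4 : 0 < Real.Gamma ((d + p) / 2) := Real.Gamma_pos_of_pos (by positivity)
  have q1 : 0 < Real.pi ^ d := Real.rpow_pos_of_pos Real.pi_pos _
  have q2 : 0 < Real.pi ^ ((d + p) / 2) := Real.rpow_pos_of_pos Real.pi_pos _
  generalize Real.pi ^ (d / 2) = a at *
  generalize Real.pi ^ (d + p / 2) = b at *
  generalize Real.pi ^ d = c at *
  generalize Real.pi ^ ((d + p) / 2) = e at *
  rw [div_mul_div_comm, div_mul_div_comm, div_div_div_eq, div_eq_div_iff (by positivity)
    (by positivity)]
  linear_combination 4 * Real.Gamma d * Real.Gamma ((d + p) / 2) *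
    Real.Gamma (d / 2) * Real.Gamma (d + p / 2) * hpi

theorem stmt_5 (d : ℕ) (hd : 1 ≤ d) (p : ℝ) (hp : 1 ≤ p) (β μ : ℝ) (hβ : 0 < β) :
    (∫ z : EuclideanSpace ℝ (Fin d) × EuclideanSpace ℝ (Fin d),
        ‖gradient (fun x => fermiDirac d β μ x z.2) z.1‖ ^ p) ^ (1 / p) =
      (∫ z : EuclideanSpace ℝ (Fin d) × EuclideanSpace ℝ (Fin d),
        ‖gradient (fun ξ => fermiDirac d β μ z.1 ξ) z.2‖ ^ p) ^ (1 / p) ∧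
    (∫ z : EuclideanSpace ℝ (Fin d) × EuclideanSpace ℝ (Fin d),
        ‖gradient (fun x => fermiDirac d β μ x z.2) z.1‖ ^ p) ^ (1 / p) =
      (omegaS d * omegaS (2 * d + p) / (omegaS (2 * d) * omegaS (d + p))) ^ (1 / p) *
        (∫ z : EuclideanSpace ℝ (Fin d) × EuclideanSpace ℝ (Fin d),
          (‖gradient (fun x => fermiDirac d β μ x z.2) z.1‖ ^ 2 +
            ‖gradient (fun ξ => fermiDirac d β μ z.1 ξ) z.2‖ ^ 2) ^ (p / 2)) ^ (1 / p) := by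
  have hp0 : 0 ≤ p := by linarith
  have : Nonempty (Fin d) := ⟨⟨0, hd⟩⟩
  simp only [norm_gradient_fermiDirac d hβ.le, norm_gradient_fermiDirac_snd d hβ.le]
  constructor
  · congr 1
    rw [Measure.volume_eq_prod, ← integral_prod_swap]
    simp only [Prod.fst_swap, Prod.snd_swap, add_comm]
  · have hd0 : (0 : ℝ) < d := by exact_mod_cast hd
    have key := integral_norm_fst_rpow_mul_radial (E := EuclideanSpace ℝ (Fin d)) hp0
      fun t ↦ fermiDiracSlope β μ t ^ p
    rw [finrank_euclideanSpace_fin, ← omegaS_ratio hd0 hp0] at key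
    have h0 (t : ℝ) := fermiDiracSlope_nonneg hβ.le μ t
    rw [← Real.mul_rpow]
    · simp only [Real.mul_rpow (norm_nonneg _) (h0 _)]
      rw [key]
      congr 2
      refine integral_congr_ae (.of_forall fun z ↦ ?_)
      simp only [mul_pow, ← add_mul]
      rw [Real.mul_rpow (by positivity) (sq_nonneg _), ← Real.rpow_natCast (fermiDiracSlope _ _ _),
        ← Real.rpow_mul (h0 _)]
      congr 2
      push_cast
      ring
    · rw [omegaS_ratio hd0 hp0]
      have := Real.Gamma_pos_of_pos hd0
      have := Real.Gamma_pos_of_pos (s := d / 2) (by positivity)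
      have := Real.Gamma_pos_of_pos (s := d + p / 2) (by positivity)
      have := Real.Gamma_pos_of_pos (s := (d + p) / 2) (by positivity)
      positivity
    · exact integral_nonneg fun z ↦ by positivity
end

section
/- Let c > 1 and let η > 0, p ≥ 1 be real numbers. Then | η^c Σ_{n=1}^∞ n^{c−1} e^{−ηpn} − Γ(c)/p^c | ≤ (ζ(c) Γ(c) / (2^{c−1} π^c)) · η^c, where ζ is the Riemann zeta function and Γ the Gamma function. -/
open MeasureTheory Set Filter Topology Complex FourierTransform

lemma integrableOn_rpow_mul_cexp_neg_mul_Ioi {a : ℝ} (ha : 0 < a) {r : ℂ} (hr : 0 < r.re) :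
    IntegrableOn (fun t : ℝ ↦ ((t ^ (a - 1) : ℝ) : ℂ) * cexp (-(r * t))) (Ioi 0) := by
  have h := integrableOn_rpow_mul_exp_neg_mul_rpow (p := 1) (s := a - 1) (by linarith) one_pos hr
  refine Integrable.mono' h ?_ ?_
  · have : Measurable fun t : ℝ ↦ ((t ^ (a - 1) : ℝ) : ℂ) * cexp (-(r * t)) := by fun_prop
    exact this.aestronglyMeasurable
  · filter_upwards [ae_restrict_mem measurableSet_Ioi] with t ht
    have ht : 0 < t := ht
    rw [norm_mul, Complex.norm_exp, norm_real, Real.norm_of_nonneg (by positivity)]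
    simp

lemma hasDerivAt_integral_rpow_mul_cexp_neg_mul_Ioi {a : ℝ} (ha : 0 < a) {r : ℂ} (hr : 0 < r.re) :
    HasDerivAt (fun s : ℂ ↦ ∫ t in Ioi (0 : ℝ), ((t ^ (a - 1) : ℝ) : ℂ) * cexp (-(s * t)))
      (∫ t in Ioi (0 : ℝ), ((t ^ (a - 1) : ℝ) : ℂ) * (cexp (-(r * t)) * (-t))) r := by
  have h := integrableOn_rpow_mul_exp_neg_mul_rpow (p := 1) (s := a) (by linarith) one_pos
    (half_pos hr)
  refine (hasDerivAt_integral_of_dominated_loc_of_deriv_le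
    (F := fun s t ↦ ((t ^ (a - 1) : ℝ) : ℂ) * cexp (-(s * t)))
    (F' := fun s t ↦ ((t ^ (a - 1) : ℝ) : ℂ) * (cexp (-(s * t)) * (-t)))
    (Metric.ball_mem_nhds r (half_pos hr)) ?_ (integrableOn_rpow_mul_cexp_neg_mul_Ioi ha hr)
    ?_ ?_ h ?_).2
  · refine Eventually.of_forall fun s ↦ ?_
    have : Measurable fun t : ℝ ↦ ((t ^ (a - 1) : ℝ) : ℂ) * cexp (-(s * t)) := by fun_prop
    exact this.aestronglyMeasurable
  · have : Measurable fun t : ℝ ↦ ((t ^ (a - 1) : ℝ) : ℂ) * (cexp (-(r * t)) * (-t)) := by fun_prop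
    exact this.aestronglyMeasurable
  · filter_upwards [ae_restrict_mem measurableSet_Ioi] with t ht s hs
    have ht : 0 < t := ht
    have hre : r.re / 2 ≤ s.re := by
      have h1 := (abs_re_le_norm (s - r)).trans (mem_ball_iff_norm.mp hs).le
      rw [sub_re] at h1
      linarith [(abs_le.mp h1).1]
    rw [norm_mul, norm_mul, Complex.norm_exp, norm_real, norm_neg, norm_real,
      Real.norm_of_nonneg (by positivity), Real.norm_of_nonneg ht.le, Real.rpow_sub_one ht.ne',
      Real.rpow_one]
    have h2 : (-(s * t) : ℂ).re ≤ -(r.re / 2) * t := by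
      simp only [neg_re, re_mul_ofReal]
      nlinarith
    calc t ^ a / t * (Real.exp (-(s * t) : ℂ).re * t)
        = t ^ a * Real.exp (-(s * t) : ℂ).re := by field_simp
      _ ≤ _ := by gcongr
  · filter_upwards with t s _
    have h1 : HasDerivAt (fun s : ℂ ↦ -(s * t)) (-t : ℂ) s := (hasDerivAt_mul_const (t : ℂ)).neg
    exact h1.cexp.const_mul _

/-- The Laplace transform of `t ^ (a - 1)` at a complex argument in the right half-plane. -/
lemma integral_rpow_mul_cexp_neg_mul_Ioi {a : ℝ} (ha : 0 < a) {r : ℂ} (hr : 0 < r.re) :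
    ∫ t in Ioi (0 : ℝ), ((t ^ (a - 1) : ℝ) : ℂ) * cexp (-(r * t)) =
      r⁻¹ ^ (a : ℂ) * (Real.Gamma a : ℂ) := by
  have hopen : IsOpen {z : ℂ | 0 < z.re} := isOpen_lt continuous_const continuous_re
  have hconn : IsPreconnected {z : ℂ | 0 < z.re} := (convex_halfSpace_re_gt 0).isPreconnected
  have hF : AnalyticOnNhd ℂ
      (fun s : ℂ ↦ ∫ t in Ioi (0 : ℝ), ((t ^ (a - 1) : ℝ) : ℂ) * cexp (-(s * t)))
      {z : ℂ | 0 < z.re} :=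
    DifferentiableOn.analyticOnNhd (fun z hz ↦
      (hasDerivAt_integral_rpow_mul_cexp_neg_mul_Ioi ha
        hz).differentiableAt.differentiableWithinAt) hopen
  have hG : AnalyticOnNhd ℂ (fun s : ℂ ↦ s⁻¹ ^ (a : ℂ) * (Real.Gamma a : ℂ))
      {z : ℂ | 0 < z.re} := by
    refine DifferentiableOn.analyticOnNhd (fun z hz ↦ ?_) hopen
    have hz : 0 < z.re := hz
    have hz0 : z ≠ 0 := by rintro rfl; simp at hz
    refine DifferentiableAt.differentiableWithinAt ?_
    refine (((differentiableAt_inv hz0).cpow_const (Or.inl ?_)).mul_const _)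
    rw [inv_re]
    exact div_pos hz (normSq_pos.mpr hz0)
  have hreal : ∀ x : ℝ, 0 < x →
      ∫ t in Ioi (0 : ℝ), ((t ^ (a - 1) : ℝ) : ℂ) * cexp (-((x : ℂ) * t)) =
        (x : ℂ)⁻¹ ^ (a : ℂ) * (Real.Gamma a : ℂ) := by
    intro x hx
    have := Real.integral_rpow_mul_exp_neg_mul_Ioi ha hx
    rw [← ofReal_inv, ← ofReal_cpow (by positivity), ← one_div, ← ofReal_mul, ← this,
      ← integral_complex_ofReal]
    simp
  refine hF.eqOn_of_preconnected_of_frequently_eq hG hconn (z₀ := 1) (by simp) ?_ hr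
  have htend : Tendsto (fun x : ℝ ↦ (x : ℂ)) (𝓝[≠] 1) (𝓝[≠] 1) := by
    refine tendsto_nhdsWithin_of_tendsto_nhds_of_eventually_within _ ?_ ?_
    · exact (continuous_ofReal.tendsto' 1 1 (by simp)).mono_left nhdsWithin_le_nhds
    · filter_upwards [self_mem_nhdsWithin] with x hx
      simpa using hx
  refine htend.frequently (Eventually.frequently ?_)
  filter_upwards [nhdsWithin_le_nhds (lt_mem_nhds one_pos)] with x hx
  exact hreal x hx

lemma fourier_max_rpow_mul_exp_neg_mul {c w : ℝ} (hc : 1 < c) (hw : 0 < w) (ξ : ℝ) :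
    𝓕 (fun x : ℝ ↦ ((max x 0 ^ (c - 1) * Real.exp (-(w * x)) : ℝ) : ℂ)) ξ =
      (w + 2 * Real.pi * ξ * I)⁻¹ ^ (c : ℂ) * (Real.Gamma c : ℂ) := by
  rw [← integral_rpow_mul_cexp_neg_mul_Ioi (by linarith) (by simpa using hw),
    Real.fourier_real_eq_integral_exp_smul, ← integral_indicator measurableSet_Ioi]
  refine integral_congr_ae (Eventually.of_forall fun x ↦ ?_)
  rcases le_or_gt x 0 with hx | hx
  · simp [hx, Real.zero_rpow (by linarith : c - 1 ≠ 0)]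
  · simp only [indicator_of_mem (mem_Ioi.mpr hx), max_eq_left hx.le, smul_eq_mul]
    push_cast
    rw [mul_left_comm, ← Complex.exp_add]
    congr 2
    ring

lemma norm_inv_cpow_mul_Gamma_le {c w : ℝ} (hc : 1 < c) {ξ : ℝ} (hξ : ξ ≠ 0) :
    ‖((w : ℂ) + 2 * Real.pi * ξ * I)⁻¹ ^ (c : ℂ) * (Real.Gamma c : ℂ)‖ ≤
      Real.Gamma c * (2 * Real.pi) ^ (-c) * |ξ| ^ (-c) := by
  have hΓ : 0 < Real.Gamma c := Real.Gamma_pos_of_pos (by linarith)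
  have hξ' : 0 < |ξ| := abs_pos.mpr hξ
  have him : 2 * Real.pi * |ξ| ≤ ‖(w : ℂ) + 2 * Real.pi * ξ * I‖ := by
    refine le_trans (le_of_eq ?_) (abs_im_le_norm _)
    simp [abs_mul, abs_of_pos Real.pi_pos]
  rw [norm_mul, norm_cpow_real, norm_real, Real.norm_of_nonneg hΓ.le, norm_inv,
    mul_comm, mul_assoc (Real.Gamma c), ← Real.mul_rpow (by positivity) hξ'.le, Real.rpow_neg (by positivity),
    ← Real.inv_rpow (by positivity)]
  have := Real.pi_pos
  gcongr

lemma summable_inv_cpow_mul_Gamma {c : ℝ} (hc : 1 < c) (w : ℝ) :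
    Summable fun k : ℤ ↦
      ((w : ℂ) + 2 * Real.pi * (k : ℝ) * I)⁻¹ ^ (c : ℂ) * (Real.Gamma c : ℂ) := by
  refine Summable.of_norm_bounded_eventually ((Real.summable_abs_int_rpow hc).mul_left
    (Real.Gamma c * (2 * Real.pi) ^ (-c))) ?_
  filter_upwards [(finite_singleton (0 : ℤ)).compl_mem_cofinite] with k hk
  exact norm_inv_cpow_mul_Gamma_le hc (Int.cast_ne_zero.mpr hk)

/-- **Lipschitz summation formula** with real parameter. -/
lemma tsum_rpow_mul_exp_neg_mul_eq_tsum_int {c w : ℝ} (hc : 1 < c) (hw : 0 < w) :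
    ((∑' n : ℕ, ((n : ℝ) + 1) ^ (c - 1) * Real.exp (-(w * ((n : ℝ) + 1))) : ℝ) : ℂ) =
      ∑' k : ℤ, ((w : ℂ) + 2 * Real.pi * (k : ℝ) * I)⁻¹ ^ (c : ℂ) * (Real.Gamma c : ℂ) := by
  have hc0 : c - 1 ≠ 0 := by linarith
  set f : ℝ → ℂ := fun x ↦ ((max x 0 ^ (c - 1) * Real.exp (-(w * x)) : ℝ) : ℂ) with hf
  have hneg : ∀ x : ℝ, x ≤ 0 → f x = 0 := fun x hx ↦ by simp [hf, hx, Real.zero_rpow hc0]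
  have hcont : Continuous f := by
    have : Continuous fun x : ℝ ↦ max x 0 ^ (c - 1) :=
      (continuous_id.max continuous_const).rpow_const fun _ ↦ Or.inr (by linarith)
    fun_prop
  have hdecay : f =O[cocompact ℝ] fun x : ℝ ↦ |x| ^ (-c) := by
    rw [cocompact_eq_atBot_atTop, Asymptotics.isBigO_sup]
    constructor
    · refine Asymptotics.IsBigO.of_bound 1 ?_
      filter_upwards [eventually_le_atBot 0] with x hx
      rw [hneg x hx, norm_zero]
      positivity
    · have h := (Asymptotics.isBigO_refl (fun x : ℝ ↦ x ^ (c - 1)) atTop).mul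
        (isLittleO_exp_neg_mul_rpow_atTop hw (-c - (c - 1))).isBigO
      refine (Asymptotics.IsBigO.of_norm_left ?_)
      refine h.congr' ?_ ?_
      all_goals filter_upwards [eventually_gt_atTop 0] with x hx
      · rw [norm_real, max_eq_left hx.le, Real.norm_of_nonneg (by positivity), neg_mul]
      · rw [← Real.rpow_add hx, abs_of_pos hx]
        congr 1
        ring
  have hsum : Summable fun k : ℤ ↦ 𝓕 f k := by
    simpa only [hf, fourier_max_rpow_mul_exp_neg_mul hc hw] using summable_inv_cpow_mul_Gamma hc w
  have hpois := Real.tsum_eq_tsum_fourier_of_rpow_decay_of_summable hcont hc hdecay hsum 0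
  have hinj : Function.Injective fun n : ℕ ↦ (n : ℤ) + 1 := fun a b h ↦ by simpa using h
  have hsupp : Function.support (fun k : ℤ ↦ f (0 + k)) ⊆ range fun n : ℕ ↦ (n : ℤ) + 1 := by
    intro k hk
    have hk0 : 0 < k := by
      by_contra! h
      exact hk (hneg _ (by simpa using h))
    exact ⟨(k - 1).toNat, by simp only; lia⟩
  rw [← hinj.tsum_eq hsupp] at hpois
  rw [ofReal_tsum]
  convert! hpois using 1
  · refine tsum_congr fun n ↦ ?_
    have : (0 : ℝ) ≤ n + 1 := by positivity
    simp [hf, max_eq_left this]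
  · refine tsum_congr fun k ↦ ?_
    rw [fourier_max_rpow_mul_exp_neg_mul hc hw]
    simp

lemma riemannZeta_ofReal_re_eq_tsum {c : ℝ} (hc : 1 < c) :
    (riemannZeta (c : ℂ)).re = ∑' n : ℕ, ((n : ℝ) + 1) ^ (-c) := by
  rw [zeta_eq_tsum_one_div_nat_add_one_cpow (by simpa using hc), ← ofReal_re (∑' n : ℕ, _),
    ofReal_tsum]
  congr 1
  refine tsum_congr fun n ↦ ?_
  have : (0 : ℝ) ≤ n + 1 := by positivity
  rw [ofReal_cpow this, ofReal_neg, cpow_neg]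
  simp

lemma abs_tsum_rpow_mul_exp_neg_mul_sub_le {c w : ℝ} (hc : 1 < c) (hw : 0 < w) :
    |(∑' n : ℕ, ((n : ℝ) + 1) ^ (c - 1) * Real.exp (-(w * ((n : ℝ) + 1)))) -
        Real.Gamma c / w ^ c| ≤
      2 * (Real.Gamma c * (2 * Real.pi) ^ (-c) * (riemannZeta (c : ℂ)).re) := by
  set F : ℤ → ℂ := fun k ↦
    ((w : ℂ) + 2 * Real.pi * (k : ℝ) * I)⁻¹ ^ (c : ℂ) * (Real.Gamma c : ℂ) with hF
  have hsum : Summable F := summable_inv_cpow_mul_Gamma hc w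
  have hzero : F 0 = ((Real.Gamma c / w ^ c : ℝ) : ℂ) := by
    have : F 0 = (w⁻¹ : ℂ) ^ (c : ℂ) * (Real.Gamma c : ℂ) := by simp [hF]
    rw [this, ← ofReal_inv, ← ofReal_cpow (by positivity), Real.inv_rpow hw.le, ← ofReal_mul,
      inv_mul_eq_div]
  have hzeta : HasSum (fun n : ℕ ↦ Real.Gamma c * (2 * Real.pi) ^ (-c) * ((n : ℝ) + 1) ^ (-c))
      (Real.Gamma c * (2 * Real.pi) ^ (-c) * (riemannZeta (c : ℂ)).re) := by
    rw [riemannZeta_ofReal_re_eq_tsum hc]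
    refine Summable.hasSum ?_ |>.mul_left _
    have := (summable_nat_add_iff 1).mpr (Real.summable_nat_rpow.mpr (neg_lt_neg hc))
    simpa using this
  have hpos : ‖∑' n : ℕ, F (n + 1)‖ ≤ _ := tsum_of_norm_bounded hzeta fun n ↦ by
    have h : (0 : ℝ) < n + 1 := by positivity
    have := norm_inv_cpow_mul_Gamma_le (w := w) hc h.ne'
    simpa [hF, abs_of_pos h] using this
  have hneg : ‖∑' n : ℕ, F (-(n + 1))‖ ≤ _ := tsum_of_norm_bounded hzeta fun n ↦ by
    have h : (0 : ℝ) < n + 1 := by positivity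
    have := norm_inv_cpow_mul_Gamma_le (w := w) hc (neg_ne_zero.mpr h.ne')
    rw [abs_neg, abs_of_pos h] at this
    simpa only [hF, Int.cast_neg, Int.cast_add, Int.cast_natCast, Int.cast_one] using this
  have hinj₁ : Function.Injective fun n : ℕ ↦ (n : ℤ) + 1 := fun a b h ↦ by simpa using h
  have hinj₂ : Function.Injective fun n : ℕ ↦ -((n : ℤ) + 1) := fun a b h ↦ by
    simp only at h
    lia
  rw [← Real.norm_eq_abs, ← norm_real, ofReal_sub, tsum_rpow_mul_exp_neg_mul_eq_tsum_int hc hw,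
    ← hzero, tsum_of_add_one_of_neg_add_one (hsum.comp_injective hinj₁)
      (hsum.comp_injective hinj₂), add_right_comm, add_sub_cancel_right, two_mul]
  exact norm_add_le_of_le hpos hneg

theorem stmt_8 (c η p : ℝ) (hc : 1 < c) (hη : 0 < η) (hp : 1 ≤ p) :
    |η ^ c * (∑' n : ℕ, ((n : ℝ) + 1) ^ (c - 1) * Real.exp (-(η * p * ((n : ℝ) + 1)))) -
        Real.Gamma c / p ^ c| ≤
      (riemannZeta (c : ℂ)).re * Real.Gamma c / (2 ^ (c - 1) * Real.pi ^ c) * η ^ c := by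
  have hp0 : 0 < p := by linarith
  have hηc : 0 < η ^ c := by positivity
  have hπ := Real.pi_pos
  have hΓ : Real.Gamma c / p ^ c = η ^ c * (Real.Gamma c / (η * p) ^ c) := by
    rw [Real.mul_rpow hη.le hp0.le]
    field_simp
  have hconst : (riemannZeta (c : ℂ)).re * Real.Gamma c / (2 ^ (c - 1) * Real.pi ^ c) =
      2 * (Real.Gamma c * (2 * Real.pi) ^ (-c) * (riemannZeta (c : ℂ)).re) := by
    rw [Real.rpow_neg (by positivity), Real.mul_rpow zero_le_two hπ.le,
      Real.rpow_sub_one two_ne_zero]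
    field_simp
  rw [hΓ, hconst, ← mul_sub, abs_mul, abs_of_pos hηc, mul_comm (η ^ c)]
  gcongr
  exact abs_tsum_rpow_mul_exp_neg_mul_sub_le hc (by positivity)
end

section
/- Let d = 3, p ∈ [1,∞), and for b ≥ 0 let A(x) = b(−x₂, x₁, 0). Let f^A_{β,μ}(x,ξ) = (1 + exp(β(|ξ − A(x)|² + |x|² − μ)))^{-1} and f_{β,μ}(x,ξ) = (1 + exp(β(|ξ|² + |x|² − μ)))^{-1} on ℝ³ × ℝ³. Then there exist constants 0 < c_p ≤ C_p depending only on p such that for all β > 0, all μ ∈ ℝ and all b ≥ 0: c_p ⟨b⟩ ‖∇_z f_{β,μ}‖_{L^p(ℝ⁶)} ≤ ‖∇_x f^A_{β,μ}‖_{L^p(ℝ⁶)} ≤ C_p ⟨b⟩ ‖∇_z f_{β,μ}‖_{L^p(ℝ⁶)}, where ⟨b⟩ = √(1 + b²), ∇_x is the gradient in the x variable and ∇_z f = (∇_x f, ∇_ξ f) is the full phase-space gradient. -/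
open MeasureTheory

/-- The vector potential `A(x) = b(−x₂, x₁, 0)` generating the uniform magnetic
field `B = (0,0,2b)`. -/
noncomputable def Amag (b : ℝ) (x : EuclideanSpace ℝ (Fin 3)) : EuclideanSpace ℝ (Fin 3) :=
  (WithLp.equiv 2 (Fin 3 → ℝ)).symm ![-(b * x 1), b * x 0, 0]

/-- The magnetic classical Fermi–Dirac distribution
`f^A_{β,μ}(x,ξ) = (1 + exp(β(|ξ − A(x)|² + |x|² − μ)))⁻¹`. -/
noncomputable def fermiDiracMag (β μ : ℝ)
    (A : EuclideanSpace ℝ (Fin 3) → EuclideanSpace ℝ (Fin 3))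
    (x ξ : EuclideanSpace ℝ (Fin 3)) : ℝ :=
  (1 + Real.exp (β * (‖ξ - A x‖ ^ 2 + ‖x‖ ^ 2 - μ)))⁻¹

section Gradient

variable {E : Type*} [NormedAddCommGroup E] [InnerProductSpace ℝ E] [CompleteSpace E]

/-- Minus twice the derivative of the Fermi–Dirac profile `F(r) = (1 + exp(β(r − μ)))⁻¹`. -/
noncomputable def fermiWeight (β μ r : ℝ) : ℝ :=
  2 * (β * Real.exp (β * (r - μ)) / (1 + Real.exp (β * (r - μ))) ^ 2)

theorem fermiWeight_nonneg {β : ℝ} (hβ : 0 < β) (μ r : ℝ) : 0 ≤ fermiWeight β μ r := by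
  unfold fermiWeight
  positivity

theorem continuous_fermiWeight (β μ : ℝ) : Continuous (fermiWeight β μ) := by
  unfold fermiWeight
  refine continuous_const.mul (Continuous.div (by fun_prop) (by fun_prop) fun r => ?_)
  positivity

theorem fermiWeight_mul_sqrt_le {β : ℝ} (hβ : 0 < β) (μ : ℝ) {r : ℝ} (hr : 0 ≤ r) :
    fermiWeight β μ r * √r ≤
      2 * β * Real.exp (β * μ) / √β * Real.exp (-(β / 2) * r) := by
  have hw : fermiWeight β μ r ≤ 2 * β * Real.exp (-(β * (r - μ))) := by
    unfold fermiWeight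
    rw [Real.exp_neg]
    have he := Real.exp_pos (β * (r - μ))
    set e := Real.exp (β * (r - μ))
    rw [← div_eq_mul_inv, ← mul_div_assoc, div_le_div_iff₀ (by positivity) he]
    nlinarith [mul_pos hβ he]
  have hs : √r ≤ Real.exp (β / 2 * r) / √β := by
    rw [le_div_iff₀ (Real.sqrt_pos.2 hβ), ← Real.sqrt_mul hr, Real.sqrt_le_left (by positivity),
      ← Real.exp_nat_mul]
    have := Real.add_one_le_exp (r * β)
    have h2 : ((2 : ℕ) : ℝ) * (β / 2 * r) = r * β := by push_cast; ring
    rw [h2]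
    linarith
  calc fermiWeight β μ r * √r
      ≤ 2 * β * Real.exp (-(β * (r - μ))) * (Real.exp (β / 2 * r) / √β) := by gcongr
    _ = 2 * β / √β * (Real.exp (-(β * (r - μ))) * Real.exp (β / 2 * r)) := by ring
    _ = 2 * β / √β * (Real.exp (β * μ) * Real.exp (-(β / 2) * r)) := by
      rw [← Real.exp_add, ← Real.exp_add]; ring_nf
    _ = _ := by ring

theorem hasGradientAt_fermi {L : E →L[ℝ] E} (hL : ∀ u v, inner ℝ u (L v) = -inner ℝ (L u) v)
    (β μ : ℝ) (x ξ : E) :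
    HasGradientAt (fun x => (1 + Real.exp (β * (‖ξ - L x‖ ^ 2 + ‖x‖ ^ 2 - μ)))⁻¹)
      (-(fermiWeight β μ (‖ξ - L x‖ ^ 2 + ‖x‖ ^ 2)) • (x + L (ξ - L x))) x := by
  have h1 : HasFDerivAt (fun x => ξ - L x) (-L) x := L.hasFDerivAt.const_sub ξ
  have h2 := (((h1.norm_sq.add (hasFDerivAt_id x).norm_sq).sub_const μ).const_mul β).exp.const_add 1
  have h3 := (hasDerivAt_inv (by simp only [Pi.add_apply]; positivity)).comp_hasFDerivAt x h2
  rw [hasGradientAt_iff_hasFDerivAt]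
  refine h3.congr_fderiv ?_
  ext v
  simp [fermiWeight, hL]
  field_simp
  ring

theorem norm_gradient_fermi {L : E →L[ℝ] E} (hL : ∀ u v, inner ℝ u (L v) = -inner ℝ (L u) v)
    {β : ℝ} (hβ : 0 < β) (μ : ℝ) (x ξ : E) :
    ‖gradient (fun x => (1 + Real.exp (β * (‖ξ - L x‖ ^ 2 + ‖x‖ ^ 2 - μ)))⁻¹) x‖ =
      fermiWeight β μ (‖ξ - L x‖ ^ 2 + ‖x‖ ^ 2) * ‖x + L (ξ - L x)‖ := by
  rw [(hasGradientAt_fermi hL β μ x ξ).gradient, norm_smul, norm_neg,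
    Real.norm_of_nonneg (fermiWeight_nonneg hβ μ _)]

end Gradient

theorem add_rpow_le_two_rpow_mul {a b p : ℝ} (ha : 0 ≤ a) (hb : 0 ≤ b) (hp : 1 ≤ p) :
    (a + b) ^ p ≤ 2 ^ (p - 1) * (a ^ p + b ^ p) := by
  lift a to NNReal using ha
  lift b to NNReal using hb
  exact_mod_cast NNReal.rpow_add_le_mul_rpow_add_rpow a b hp

section RadialWeight

variable {E : Type*} [NormedAddCommGroup E] [InnerProductSpace ℝ E] [FiniteDimensional ℝ E]
  [MeasurableSpace E] [BorelSpace E]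

/-- A volume-preserving map of phase space that preserves `|x|² + |y|²`. -/
structure IsRadialSymmetry (S : E × E → E × E) : Prop where
  measurePreserving : MeasurePreserving S volume volume
  norm_sq : ∀ z, ‖(S z).1‖ ^ 2 + ‖(S z).2‖ ^ 2 = ‖z.1‖ ^ 2 + ‖z.2‖ ^ 2

theorem IsRadialSymmetry.id : IsRadialSymmetry (id : E × E → E × E) :=
  ⟨.id _, fun _ => rfl⟩

theorem IsRadialSymmetry.swap : IsRadialSymmetry (Prod.swap : E × E → E × E) :=
  ⟨Measure.measurePreserving_swap, fun _ => add_comm _ _⟩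

theorem IsRadialSymmetry.prodMap_id (R : E ≃ₗᵢ[ℝ] E) :
    IsRadialSymmetry (Prod.map (_root_.id : E → E) R) :=
  ⟨(MeasurePreserving.id _).prod R.measurePreserving, fun z => by simp⟩

/-- The `p`-th power of the `L^p` norm of `w(|x|² + |y|²) h(x, y)`. -/
noncomputable def radialMoment (w : ℝ → ℝ) (p : ℝ) (h : E × E → ℝ) : ℝ :=
  ∫ z, (w (‖z.1‖ ^ 2 + ‖z.2‖ ^ 2) * h z) ^ p

variable {w : ℝ → ℝ} {p : ℝ}

theorem radialMoment_nonneg (hw : ∀ r, 0 ≤ w r) {h : E × E → ℝ} (hh : ∀ z, 0 ≤ h z) :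
    0 ≤ radialMoment w p h :=
  integral_nonneg fun z => Real.rpow_nonneg (mul_nonneg (hw _) (hh z)) _

theorem radialMoment_const_mul_rpow (hp : 1 ≤ p) (hw : ∀ r, 0 ≤ w r) {h : E × E → ℝ}
    (hh : ∀ z, 0 ≤ h z) {c : ℝ} (hc : 0 ≤ c) :
    radialMoment w p (fun z => c * h z) ^ (1 / p) = c * radialMoment w p h ^ (1 / p) := by
  have h1 : radialMoment w p (fun z => c * h z) = c ^ p * radialMoment w p h := by
    unfold radialMoment
    rw [← integral_const_mul]
    congr 1 with z
    rw [mul_left_comm, Real.mul_rpow hc (mul_nonneg (hw _) (hh z))]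
  rw [h1, Real.mul_rpow (by positivity) (radialMoment_nonneg hw hh), ← Real.rpow_mul hc,
    mul_one_div_cancel (by positivity), Real.rpow_one]

theorem integrable_radial_rpow (hp : 1 ≤ p) (hwc : Continuous w) (hw : ∀ r, 0 ≤ w r)
    (hint : Integrable fun z : E × E =>
      (w (‖z.1‖ ^ 2 + ‖z.2‖ ^ 2) * √(‖z.1‖ ^ 2 + ‖z.2‖ ^ 2)) ^ p)
    {h : E × E → ℝ} (hc : Continuous h) (hh : ∀ z, 0 ≤ h z) {K : ℝ} (hK : 0 ≤ K)
    (hle : ∀ z, h z ≤ K * √(‖z.1‖ ^ 2 + ‖z.2‖ ^ 2)) :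
    Integrable fun z : E × E => (w (‖z.1‖ ^ 2 + ‖z.2‖ ^ 2) * h z) ^ p := by
  refine (hint.const_mul (K ^ p)).mono' ?_ (.of_forall fun z => ?_)
  · refine Continuous.aestronglyMeasurable (Continuous.rpow_const ?_ fun _ => .inr (by positivity))
    exact (hwc.comp (by fun_prop)).mul hc
  · have h0 : 0 ≤ w (‖z.1‖ ^ 2 + ‖z.2‖ ^ 2) * h z := mul_nonneg (hw _) (hh z)
    rw [Real.norm_of_nonneg (Real.rpow_nonneg h0 _),
      ← Real.mul_rpow hK (mul_nonneg (hw _) (Real.sqrt_nonneg _)), mul_left_comm]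
    exact Real.rpow_le_rpow h0 (mul_le_mul_of_nonneg_left (hle z) (hw _)) (by positivity)

theorem radialMoment_le_of_le_add (hp : 1 ≤ p) (hw : ∀ r, 0 ≤ w r) {h h₁ h₂ : E × E → ℝ}
    (hh : ∀ z, 0 ≤ h z) (hh₁ : ∀ z, 0 ≤ h₁ z) (hh₂ : ∀ z, 0 ≤ h₂ z)
    (hi₁ : Integrable fun z : E × E => (w (‖z.1‖ ^ 2 + ‖z.2‖ ^ 2) * h₁ z) ^ p)
    (hi₂ : Integrable fun z : E × E => (w (‖z.1‖ ^ 2 + ‖z.2‖ ^ 2) * h₂ z) ^ p)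
    {S₁ S₂ : E × E → E × E} (hS₁ : IsRadialSymmetry S₁) (hS₂ : IsRadialSymmetry S₂)
    (hle : ∀ z, h z ≤ h₁ (S₁ z) + h₂ (S₂ z)) {M : ℝ}
    (hM₁ : radialMoment w p h₁ ≤ M) (hM₂ : radialMoment w p h₂ ≤ M) :
    radialMoment w p h ≤ 2 ^ p * M := by
  have key : ∀ {g : E × E → ℝ} {S : E × E → E × E}, IsRadialSymmetry S →
      Integrable (fun z : E × E => (w (‖z.1‖ ^ 2 + ‖z.2‖ ^ 2) * g z) ^ p) →
      Integrable (fun z : E × E => (w (‖z.1‖ ^ 2 + ‖z.2‖ ^ 2) * g (S z)) ^ p) ∧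
      ∫ z : E × E, (w (‖z.1‖ ^ 2 + ‖z.2‖ ^ 2) * g (S z)) ^ p = radialMoment w p g := by
    intro g S hS hg
    have hcomp := hS.measurePreserving.integrable_comp_of_integrable hg
    have heq : (fun z : E × E => (w (‖z.1‖ ^ 2 + ‖z.2‖ ^ 2) * g z) ^ p) ∘ S =
        fun z : E × E => (w (‖z.1‖ ^ 2 + ‖z.2‖ ^ 2) * g (S z)) ^ p := by
      ext z
      simp [hS.norm_sq]
    rw [heq] at hcomp
    refine ⟨hcomp, ?_⟩
    unfold radialMoment
    conv_rhs => rw [← hS.measurePreserving.map_eq]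
    rw [integral_map hS.measurePreserving.measurable.aemeasurable
      (by rw [hS.measurePreserving.map_eq]; exact hg.aestronglyMeasurable)]
    simp [hS.norm_sq]
  obtain ⟨hj₁, he₁⟩ := key hS₁ hi₁
  obtain ⟨hj₂, he₂⟩ := key hS₂ hi₂
  calc radialMoment w p h
      ≤ ∫ z : E × E, 2 ^ (p - 1) * ((w (‖z.1‖ ^ 2 + ‖z.2‖ ^ 2) * h₁ (S₁ z)) ^ p +
          (w (‖z.1‖ ^ 2 + ‖z.2‖ ^ 2) * h₂ (S₂ z)) ^ p) := by
        refine integral_mono_of_nonneg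
          (.of_forall fun z => Real.rpow_nonneg (mul_nonneg (hw _) (hh z)) _)
          ((hj₁.add hj₂).const_mul _) (.of_forall fun z => ?_)
        refine (Real.rpow_le_rpow (mul_nonneg (hw _) (hh z))
          (mul_le_mul_of_nonneg_left (hle z) (hw _)) (by positivity)).trans ?_
        rw [mul_add]
        exact add_rpow_le_two_rpow_mul (mul_nonneg (hw _) (hh₁ _)) (mul_nonneg (hw _) (hh₂ _)) hp
    _ = 2 ^ (p - 1) * (radialMoment w p h₁ + radialMoment w p h₂) := by
        rw [integral_const_mul, integral_add hj₁ hj₂, he₁, he₂]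
    _ ≤ 2 ^ (p - 1) * (M + M) := by gcongr
    _ = 2 ^ p * M := by
        rw [Real.rpow_sub_one (by norm_num)]; ring

theorem integrable_fermiWeight_mul_sqrt_rpow (hp : 1 ≤ p) {β : ℝ} (hβ : 0 < β) (μ : ℝ) :
    Integrable fun z : E × E =>
      (fermiWeight β μ (‖z.1‖ ^ 2 + ‖z.2‖ ^ 2) * √(‖z.1‖ ^ 2 + ‖z.2‖ ^ 2)) ^ p := by
  have hg : Integrable fun x : E => Real.exp (-(β / 2 * p) * ‖x‖ ^ 2) := by
    have := (GaussianFourier.integrable_cexp_neg_mul_sq_norm_add (V := E)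
      (b := ((β / 2 * p : ℝ) : ℂ)) (by simp; positivity) 0 0).norm
    simpa [Complex.norm_exp, ← Complex.ofReal_pow] using this
  refine ((hg.mul_prod hg).const_mul ((2 * β * Real.exp (β * μ) / √β) ^ p)).mono' ?_
    (.of_forall fun z => ?_)
  · refine Continuous.aestronglyMeasurable (Continuous.rpow_const ?_ fun _ => .inr (by positivity))
    exact ((continuous_fermiWeight β μ).comp (by fun_prop)).mul (by fun_prop)
  · have h0 : 0 ≤ fermiWeight β μ (‖z.1‖ ^ 2 + ‖z.2‖ ^ 2) * √(‖z.1‖ ^ 2 + ‖z.2‖ ^ 2) :=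
      mul_nonneg (fermiWeight_nonneg hβ μ _) (Real.sqrt_nonneg _)
    rw [Real.norm_of_nonneg (Real.rpow_nonneg h0 _)]
    refine (Real.rpow_le_rpow h0 (fermiWeight_mul_sqrt_le hβ μ (by positivity))
      (by positivity)).trans_eq ?_
    rw [Real.mul_rpow (by positivity) (by positivity), ← Real.exp_mul, ← Real.exp_add]
    ring_nf

theorem measurePreserving_sub_map (L : E →L[ℝ] E) :
    MeasurePreserving (fun z : E × E => (z.1, z.2 - L z.1)) volume volume := by
  refine (MeasurePreserving.id (volume : Measure E)).skew_product
    (g := fun x y => y - L x) (by fun_prop) (.of_forall fun x => ?_)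
  exact (measurePreserving_sub_right (volume : Measure E) (L x)).map_eq

theorem integral_shear_eq_radialMoment (hp : 1 ≤ p) (hwc : Continuous w) (L : E →L[ℝ] E) :
    ∫ z : E × E, (w (‖z.2 - L z.1‖ ^ 2 + ‖z.1‖ ^ 2) * ‖z.1 + L (z.2 - L z.1)‖) ^ p =
      radialMoment w p fun z => ‖z.1 + L z.2‖ := by
  have hS := measurePreserving_sub_map L
  unfold radialMoment
  conv_rhs => rw [← hS.map_eq]
  rw [integral_map hS.measurable.aemeasurable]
  · simp [add_comm]
  · refine Continuous.aestronglyMeasurable (Continuous.rpow_const ?_ fun _ => .inr (by positivity))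
    exact (hwc.comp (by fun_prop)).mul (by fun_prop)

end RadialWeight

/-- `Amag b` as a continuous linear map. -/
noncomputable def AmagCLM (b : ℝ) : EuclideanSpace ℝ (Fin 3) →L[ℝ] EuclideanSpace ℝ (Fin 3) :=
  LinearMap.toContinuousLinearMap
    { toFun := Amag b
      map_add' := fun x y => by
        ext i; fin_cases i <;> simp [Amag] <;> ring
      map_smul' := fun c x => by
        ext i; fin_cases i <;> simp [Amag] <;> ring }

theorem AmagCLM_apply (b : ℝ) (x : EuclideanSpace ℝ (Fin 3)) : AmagCLM b x = Amag b x := rfl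

theorem inner_AmagCLM (b : ℝ) (u v : EuclideanSpace ℝ (Fin 3)) :
    inner ℝ u (AmagCLM b v) = -inner ℝ (AmagCLM b u) v := by
  simp [AmagCLM_apply, Amag, PiLp.inner_apply, Fin.sum_univ_three]
  ring

theorem norm_AmagCLM_sq (b : ℝ) (x : EuclideanSpace ℝ (Fin 3)) :
    ‖AmagCLM b x‖ ^ 2 = b ^ 2 * (x 0 ^ 2 + x 1 ^ 2) := by
  simp [AmagCLM_apply, Amag, EuclideanSpace.norm_sq_eq, Fin.sum_univ_three]
  ring

theorem norm_AmagCLM_le {b : ℝ} (hb : 0 ≤ b) (x : EuclideanSpace ℝ (Fin 3)) :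
    ‖AmagCLM b x‖ ≤ b * ‖x‖ := by
  refine le_of_sq_le_sq ?_ (by positivity)
  rw [norm_AmagCLM_sq, mul_pow, EuclideanSpace.norm_sq_eq, Fin.sum_univ_three]
  simp only [Real.norm_eq_abs, sq_abs]
  nlinarith [mul_nonneg (sq_nonneg b) (sq_nonneg (x 2))]

/-- The isometry exchanging the first and the third coordinates. -/
noncomputable def swapCoord : EuclideanSpace ℝ (Fin 3) ≃ₗᵢ[ℝ] EuclideanSpace ℝ (Fin 3) :=
  LinearIsometryEquiv.piLpCongrLeft 2 ℝ ℝ (Equiv.swap 0 2)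

theorem mul_norm_le_norm_AmagCLM_add (b : ℝ) (x : EuclideanSpace ℝ (Fin 3)) :
    b * ‖x‖ ≤ ‖AmagCLM b x‖ + ‖AmagCLM b (swapCoord x)‖ := by
  refine le_of_sq_le_sq ?_ (by positivity)
  have h : b ^ 2 * ‖x‖ ^ 2 ≤ ‖AmagCLM b x‖ ^ 2 + ‖AmagCLM b (swapCoord x)‖ ^ 2 := by
    have h0 : swapCoord x 0 = x 2 := by simp [swapCoord, LinearIsometryEquiv.piLpCongrLeft_apply]
    have h1 : swapCoord x 1 = x 1 := by
      simp [swapCoord, LinearIsometryEquiv.piLpCongrLeft_apply, Equiv.swap_apply_def]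
    rw [norm_AmagCLM_sq, norm_AmagCLM_sq, EuclideanSpace.norm_sq_eq, Fin.sum_univ_three, h0, h1]
    simp only [Real.norm_eq_abs, sq_abs]
    nlinarith [mul_nonneg (sq_nonneg b) (sq_nonneg (x 1))]
  nlinarith [mul_nonneg (norm_nonneg (AmagCLM b x)) (norm_nonneg (AmagCLM b (swapCoord x)))]

theorem norm_add_AmagCLM_le {b : ℝ} (hb : 0 ≤ b) (x y : EuclideanSpace ℝ (Fin 3)) :
    ‖x + AmagCLM b y‖ ≤ √(1 + b ^ 2) * √(‖x‖ ^ 2 + ‖y‖ ^ 2) := by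
  rw [← Real.sqrt_mul (by positivity)]
  refine Real.le_sqrt_of_sq_le ?_
  have h : ‖x + AmagCLM b y‖ ≤ ‖x‖ + b * ‖y‖ :=
    (norm_add_le _ _).trans (by gcongr; exact norm_AmagCLM_le hb y)
  calc ‖x + AmagCLM b y‖ ^ 2 ≤ (‖x‖ + b * ‖y‖) ^ 2 := by gcongr
    _ ≤ _ := by nlinarith [sq_nonneg (b * ‖x‖ - ‖y‖)]

theorem radialMoment_sqrt_le_rpow_mul {w : ℝ → ℝ} {p b : ℝ} (hp : 1 ≤ p) (hb : 0 ≤ b)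
    (hwc : Continuous w) (hw : ∀ r, 0 ≤ w r)
    (hint : Integrable fun z : EuclideanSpace ℝ (Fin 3) × EuclideanSpace ℝ (Fin 3) =>
      (w (‖z.1‖ ^ 2 + ‖z.2‖ ^ 2) * √(‖z.1‖ ^ 2 + ‖z.2‖ ^ 2)) ^ p) :
    radialMoment w p (fun z : EuclideanSpace ℝ (Fin 3) × EuclideanSpace ℝ (Fin 3) =>
        √(1 + b ^ 2) * √(‖z.1‖ ^ 2 + ‖z.2‖ ^ 2)) ≤
      16 ^ p * radialMoment w p fun z => ‖z.1 + AmagCLM b z.2‖ := by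
  let E := EuclideanSpace ℝ (Fin 3)
  have hfst (z : E × E) : ‖z.1‖ ≤ √(‖z.1‖ ^ 2 + ‖z.2‖ ^ 2) :=
    Real.le_sqrt_of_sq_le (by nlinarith [sq_nonneg ‖z.2‖])
  have hsnd (z : E × E) : ‖z.2‖ ≤ √(‖z.1‖ ^ 2 + ‖z.2‖ ^ 2) :=
    Real.le_sqrt_of_sq_le (by nlinarith [sq_nonneg ‖z.1‖])
  have hneg : IsRadialSymmetry (Prod.map (id : E → E) (LinearIsometryEquiv.neg ℝ)) :=
    .prodMap_id _
  have iT := integrable_radial_rpow hp hwc hw hint (h := fun z => ‖z.1 + AmagCLM b z.2‖)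
    (by fun_prop) (fun _ => norm_nonneg _) (Real.sqrt_nonneg _)
    (fun z => norm_add_AmagCLM_le hb z.1 z.2)
  have iA := integrable_radial_rpow hp hwc hw hint (h := fun z => ‖AmagCLM b z.2‖)
    (by fun_prop) (fun _ => norm_nonneg _) hb
    (fun z => (norm_AmagCLM_le hb z.2).trans (by gcongr; exact hsnd z))
  have iX := integrable_radial_rpow hp hwc hw hint (h := fun z => ‖z.1‖)
    (by fun_prop) (fun _ => norm_nonneg _) zero_le_one (fun z => by simpa using hfst z)
  have iY := integrable_radial_rpow hp hwc hw hint (h := fun z => b * ‖z.2‖)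
    (by fun_prop) (fun _ => by positivity) hb (fun z => by gcongr; exact hsnd z)
  have iB := integrable_radial_rpow hp hwc hw hint (h := fun z => √(1 + b ^ 2) * ‖z.1‖)
    (by fun_prop) (fun _ => by positivity) (Real.sqrt_nonneg _)
    (fun z => by gcongr; exact hfst z)
  set M := radialMoment w p fun z : E × E => ‖z.1 + AmagCLM b z.2‖
  have hM0 : 0 ≤ M := radialMoment_nonneg hw fun _ => norm_nonneg _
  have hX : radialMoment w p (fun z : E × E => ‖z.1‖) ≤ 2 ^ p * M := by
    refine radialMoment_le_of_le_add hp hw (fun _ => norm_nonneg _) (fun _ => norm_nonneg _)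
      (fun _ => norm_nonneg _) iT iT .id hneg (fun z => ?_) le_rfl le_rfl
    have h := norm_add_le (z.1 + AmagCLM b z.2) (z.1 + AmagCLM b (-z.2))
    have h2 : z.1 + AmagCLM b z.2 + (z.1 + AmagCLM b (-z.2)) = (2 : ℝ) • z.1 := by
      rw [map_neg, two_smul]; abel
    rw [h2, norm_smul, Real.norm_two] at h
    change _ ≤ ‖z.1 + AmagCLM b z.2‖ + ‖z.1 + AmagCLM b (-z.2)‖
    linarith [norm_nonneg z.1]
  have hA : radialMoment w p (fun z : E × E => ‖AmagCLM b z.2‖) ≤ 2 ^ p * M := by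
    refine radialMoment_le_of_le_add hp hw (fun _ => norm_nonneg _) (fun _ => norm_nonneg _)
      (fun _ => norm_nonneg _) iT iT .id hneg (fun z => ?_) le_rfl le_rfl
    have h := norm_sub_le (z.1 + AmagCLM b z.2) (z.1 + AmagCLM b (-z.2))
    have h2 : z.1 + AmagCLM b z.2 - (z.1 + AmagCLM b (-z.2)) = (2 : ℝ) • AmagCLM b z.2 := by
      rw [map_neg, two_smul]; abel
    rw [h2, norm_smul, Real.norm_two] at h
    change _ ≤ ‖z.1 + AmagCLM b z.2‖ + ‖z.1 + AmagCLM b (-z.2)‖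
    linarith [norm_nonneg (AmagCLM b z.2)]
  have hY : radialMoment w p (fun z : E × E => b * ‖z.2‖) ≤ 2 ^ p * (2 ^ p * M) :=
    radialMoment_le_of_le_add hp hw (fun _ => by positivity) (fun _ => norm_nonneg _)
      (fun _ => norm_nonneg _) iA iA .id (.prodMap_id swapCoord)
      (fun z => mul_norm_le_norm_AmagCLM_add b z.2) hA hA
  have hX' : radialMoment w p (fun z : E × E => ‖z.1‖) ≤ 2 ^ p * (2 ^ p * M) :=
    hX.trans (le_mul_of_one_le_left (by positivity)
      (Real.one_le_rpow one_le_two (by positivity)))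
  have hB : radialMoment w p (fun z : E × E => √(1 + b ^ 2) * ‖z.1‖) ≤
      2 ^ p * (2 ^ p * (2 ^ p * M)) := by
    refine radialMoment_le_of_le_add hp hw (fun _ => by positivity) (fun _ => norm_nonneg _)
      (fun _ => by positivity) iX iY .id .swap (fun z => ?_) hX' hY
    have h : √(1 + b ^ 2) ≤ 1 + b := Real.sqrt_le_iff.2 ⟨by positivity, by nlinarith⟩
    change _ ≤ ‖z.1‖ + b * ‖z.1‖
    nlinarith [norm_nonneg z.1]
  have hD : radialMoment w p (fun z : E × E =>
      √(1 + b ^ 2) * √(‖z.1‖ ^ 2 + ‖z.2‖ ^ 2)) ≤ 2 ^ p * (2 ^ p * (2 ^ p * (2 ^ p * M))) := by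
    refine radialMoment_le_of_le_add hp hw (fun _ => by positivity) (fun _ => by positivity)
      (fun _ => by positivity) iB iB .id .swap (fun z => ?_) hB hB
    change _ ≤ √(1 + b ^ 2) * ‖z.1‖ + √(1 + b ^ 2) * ‖z.2‖
    rw [← mul_add]
    gcongr
    exact Real.sqrt_le_iff.2 ⟨by positivity,
      by nlinarith [mul_nonneg (norm_nonneg z.1) (norm_nonneg z.2)]⟩
  refine hD.trans_eq ?_
  rw [show (16 : ℝ) = 2 * 2 * 2 * 2 by norm_num, Real.mul_rpow (by norm_num) (by norm_num),
    Real.mul_rpow (by norm_num) (by norm_num), Real.mul_rpow (by norm_num) (by norm_num)]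
  ring

theorem norm_gradient_fermiDiracMag_Amag {β : ℝ} (hβ : 0 < β) (μ b : ℝ)
    (x ξ : EuclideanSpace ℝ (Fin 3)) :
    ‖gradient (fun x => fermiDiracMag β μ (Amag b) x ξ) x‖ =
      fermiWeight β μ (‖ξ - AmagCLM b x‖ ^ 2 + ‖x‖ ^ 2) * ‖x + AmagCLM b (ξ - AmagCLM b x)‖ :=
  norm_gradient_fermi (inner_AmagCLM b) hβ μ x ξ

theorem norm_gradient_fermiDiracMag_zero {β : ℝ} (hβ : 0 < β) (μ : ℝ)
    (x ξ : EuclideanSpace ℝ (Fin 3)) :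
    ‖gradient (fun x => fermiDiracMag β μ (fun _ => 0) x ξ) x‖ =
      fermiWeight β μ (‖x‖ ^ 2 + ‖ξ‖ ^ 2) * ‖x‖ := by
  have h := norm_gradient_fermi (L := (0 : EuclideanSpace ℝ (Fin 3) →L[ℝ] _)) (by simp) hβ μ x ξ
  simp only [zero_apply, sub_zero, add_zero] at h
  simpa [fermiDiracMag, add_comm (‖ξ‖ ^ 2)] using h

theorem fermiDiracMag_zero_comm (β μ : ℝ) (x ξ : EuclideanSpace ℝ (Fin 3)) :
    fermiDiracMag β μ (fun _ => 0) x ξ = fermiDiracMag β μ (fun _ => 0) ξ x := by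
  simp [fermiDiracMag, add_comm (‖ξ‖ ^ 2)]

theorem gradient_sq_rpow_eq {β : ℝ} (hβ : 0 < β) (μ p : ℝ) (x ξ : EuclideanSpace ℝ (Fin 3)) :
    (‖gradient (fun x => fermiDiracMag β μ (fun _ => 0) x ξ) x‖ ^ 2 +
      ‖gradient (fun ξ => fermiDiracMag β μ (fun _ => 0) x ξ) ξ‖ ^ 2) ^ (p / 2) =
      (fermiWeight β μ (‖x‖ ^ 2 + ‖ξ‖ ^ 2) * √(‖x‖ ^ 2 + ‖ξ‖ ^ 2)) ^ p := by
  have hw := fermiWeight_nonneg hβ μ (‖x‖ ^ 2 + ‖ξ‖ ^ 2)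
  simp only [fermiDiracMag_zero_comm β μ x]
  rw [norm_gradient_fermiDiracMag_zero hβ, norm_gradient_fermiDiracMag_zero hβ,
    add_comm (‖ξ‖ ^ 2), mul_pow, mul_pow, ← mul_add]
  set W := fermiWeight β μ (‖x‖ ^ 2 + ‖ξ‖ ^ 2)
  have h : W * √(‖x‖ ^ 2 + ‖ξ‖ ^ 2) = √(W ^ 2 * (‖x‖ ^ 2 + ‖ξ‖ ^ 2)) := by
    rw [Real.sqrt_mul (sq_nonneg W), Real.sqrt_sq hw]
  rw [h, Real.sqrt_eq_rpow, ← Real.rpow_mul (by positivity)]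
  ring_nf

theorem stmt_16 (p : ℝ) (hp : 1 ≤ p) :
    ∃ c C : ℝ, 0 < c ∧ c ≤ C ∧
      ∀ (β μ b : ℝ), 0 < β → 0 ≤ b →
        c * Real.sqrt (1 + b ^ 2) *
            (∫ z : EuclideanSpace ℝ (Fin 3) × EuclideanSpace ℝ (Fin 3),
              (‖gradient (fun x => fermiDiracMag β μ (fun _ => 0) x z.2) z.1‖ ^ 2 +
                ‖gradient (fun ξ => fermiDiracMag β μ (fun _ => 0) z.1 ξ) z.2‖ ^ 2) ^
                (p / 2)) ^ (1 / p) ≤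
          (∫ z : EuclideanSpace ℝ (Fin 3) × EuclideanSpace ℝ (Fin 3),
            ‖gradient (fun x => fermiDiracMag β μ (Amag b) x z.2) z.1‖ ^ p) ^ (1 / p) ∧
        (∫ z : EuclideanSpace ℝ (Fin 3) × EuclideanSpace ℝ (Fin 3),
            ‖gradient (fun x => fermiDiracMag β μ (Amag b) x z.2) z.1‖ ^ p) ^ (1 / p) ≤
          C * Real.sqrt (1 + b ^ 2) *
            (∫ z : EuclideanSpace ℝ (Fin 3) × EuclideanSpace ℝ (Fin 3),
              (‖gradient (fun x => fermiDiracMag β μ (fun _ => 0) x z.2) z.1‖ ^ 2 +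
                ‖gradient (fun ξ => fermiDiracMag β μ (fun _ => 0) z.1 ξ) z.2‖ ^ 2) ^
                (p / 2)) ^ (1 / p) := by
  refine ⟨1 / 16, 1, by norm_num, by norm_num, fun β μ b hβ hb => ?_⟩
  have hwc := continuous_fermiWeight β μ
  have hw := fermiWeight_nonneg hβ μ
  have hint := integrable_fermiWeight_mul_sqrt_rpow (E := EuclideanSpace ℝ (Fin 3)) hp hβ μ
  simp only [norm_gradient_fermiDiracMag_Amag hβ, gradient_sq_rpow_eq hβ,
    integral_shear_eq_radialMoment hp hwc]
  have hT := radialMoment_nonneg (p := p) hw fun z => norm_nonneg (z.1 + AmagCLM b z.2)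
  have hscale := radialMoment_const_mul_rpow hp hw
    (h := fun z : EuclideanSpace ℝ (Fin 3) × EuclideanSpace ℝ (Fin 3) => √(‖z.1‖ ^ 2 + ‖z.2‖ ^ 2))
    (fun _ => Real.sqrt_nonneg _) (Real.sqrt_nonneg (1 + b ^ 2))
  change _ = _ * (∫ z, _) ^ (1 / p) at hscale
  have hp0 : (0 : ℝ) ≤ 1 / p := by positivity
  rw [mul_assoc, mul_assoc, ← hscale, one_mul]
  constructor
  · have h := Real.rpow_le_rpow (radialMoment_nonneg hw fun _ => by positivity)
      (radialMoment_sqrt_le_rpow_mul hp hb hwc hw hint) hp0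
    rw [Real.mul_rpow (by positivity) hT, ← Real.rpow_mul (by norm_num),
      mul_one_div_cancel (by positivity), Real.rpow_one] at h
    linarith
  · refine Real.rpow_le_rpow hT (integral_mono_of_nonneg
      (.of_forall fun z => Real.rpow_nonneg (mul_nonneg (hw _) (norm_nonneg _)) _)
      (integrable_radial_rpow hp hwc hw hint (by fun_prop) (fun _ => by positivity)
        (Real.sqrt_nonneg _) fun _ => le_rfl) (.of_forall fun z => ?_)) hp0
    exact Real.rpow_le_rpow (mul_nonneg (hw _) (norm_nonneg _))
      (mul_le_mul_of_nonneg_left (norm_add_AmagCLM_le hb z.1 z.2) (hw _)) (by positivity)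
end

section
/- Let d = 3 and for b ≥ 0 let A(x) = b(−x₂, x₁, 0). Let f^A_{β,μ}(x,ξ) = (1 + exp(β(|ξ − A(x)|² + |x|² − μ)))^{-1} and f_{β,μ}(x,ξ) = (1 + exp(β(|ξ|² + |x|² − μ)))^{-1} on ℝ³ × ℝ³. Then for all β > 0, μ ∈ ℝ and b ≥ 0: ‖∇_x f^A_{β,μ}‖²_{L²(ℝ⁶)} = ((3 + 2b²)/6) ‖∇_z f_{β,μ}‖²_{L²(ℝ⁶)}, where ∇_x is the gradient in the x variable and ∇_z f = (∇_x f, ∇_ξ f) is the full phase-space gradient. -/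
open MeasureTheory

/-- The square of the derivative of the Fermi–Dirac profile `r ↦ (1 + exp(β(r − μ)))⁻¹`. -/
noncomputable def fermiDerivSq (β μ r : ℝ) : ℝ :=
  (β * Real.exp (β * (r - μ)) / (1 + Real.exp (β * (r - μ))) ^ 2) ^ 2

lemma hasDerivAt_fermiProfile (β μ r : ℝ) :
    HasDerivAt (fun r : ℝ => (1 + Real.exp (β * (r - μ)))⁻¹)
      (-(β * Real.exp (β * (r - μ)) / (1 + Real.exp (β * (r - μ))) ^ 2)) r := by
  have h : HasDerivAt (fun r : ℝ => 1 + Real.exp (β * (r - μ)))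
      (Real.exp (β * (r - μ)) * (β * 1)) r :=
    ((((hasDerivAt_id r).sub_const μ).const_mul β).exp).const_add 1
  have h0 : 1 + Real.exp (β * (r - μ)) ≠ 0 := by positivity
  refine (h.inv h0).congr_deriv ?_
  ring

lemma continuous_fermiDerivSq (β μ : ℝ) : Continuous (fermiDerivSq β μ) := by
  unfold fermiDerivSq
  refine (Continuous.div (by fun_prop) (by fun_prop) fun r => ?_).pow 2
  positivity

lemma fermiDerivSq_nonneg (β μ r : ℝ) : 0 ≤ fermiDerivSq β μ r := sq_nonneg _

lemma fermiDerivSq_le (β μ r : ℝ) :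
    fermiDerivSq β μ r ≤ β ^ 2 * Real.exp (2 * β * μ) * Real.exp (-(2 * β * r)) := by
  have hexp : β ^ 2 * Real.exp (2 * β * μ) * Real.exp (-(2 * β * r)) =
      (β / Real.exp (β * (r - μ))) ^ 2 := by
    rw [div_pow, ← Real.exp_nat_mul, mul_assoc, ← Real.exp_add, div_eq_mul_inv, ← Real.exp_neg]
    congr 2
    push_cast
    ring
  rw [hexp, fermiDerivSq]
  set e := Real.exp (β * (r - μ)) with he
  have hpos : 0 < e := Real.exp_pos _
  refine sq_le_sq.2 ?_
  rw [abs_div, abs_div, abs_mul, abs_of_pos hpos, abs_of_pos (by positivity : 0 < (1 + e) ^ 2),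
    div_le_div_iff₀ (by positivity) hpos]
  have := abs_nonneg β
  have h2 : e * e ≤ (1 + e) ^ 2 := by nlinarith
  calc |β| * e * e = |β| * (e * e) := by ring
    _ ≤ |β| * (1 + e) ^ 2 := by gcongr

lemma hasGradientAt_magneticEnergy (b : ℝ) (x ξ : EuclideanSpace ℝ (Fin 3)) :
    HasGradientAt (fun x => ‖ξ - Amag b x‖ ^ 2 + ‖x‖ ^ 2)
      ((2 : ℝ) • !₂[x 0 - b * (ξ - Amag b x) 1, x 1 + b * (ξ - Amag b x) 0, x 2]) x := by
  have hp : ∀ i : Fin 3, HasFDerivAt (fun y : EuclideanSpace ℝ (Fin 3) => y i)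
      (EuclideanSpace.proj i : EuclideanSpace ℝ (Fin 3) →L[ℝ] ℝ) x := fun i =>
    (EuclideanSpace.proj i : EuclideanSpace ℝ (Fin 3) →L[ℝ] ℝ).hasFDerivAt
  have hq : (fun x => ‖ξ - Amag b x‖ ^ 2 + ‖x‖ ^ 2) = fun y : EuclideanSpace ℝ (Fin 3) =>
      (ξ 0 + b * y 1) ^ 2 + (ξ 1 - b * y 0) ^ 2 + ξ 2 ^ 2 +
        (y 0 ^ 2 + y 1 ^ 2 + y 2 ^ 2) := by
    funext y
    simp [EuclideanSpace.norm_sq_eq, Fin.sum_univ_three, Amag]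
  rw [hq, hasGradientAt_iff_hasFDerivAt]
  refine ((((((hp 1).const_mul b).const_add (ξ 0)).pow 2).add
    ((((hp 0).const_mul b).const_sub (ξ 1)).pow 2)).add_const (ξ 2 ^ 2) |>.add
    ((((hp 0).pow 2).add ((hp 1).pow 2)).add ((hp 2).pow 2))).congr_fderiv ?_
  ext v
  simp [PiLp.inner_apply, Fin.sum_univ_three, Amag]
  ring

lemma norm_sq_vec (u v w : ℝ) : ‖!₂[u, v, w]‖ ^ 2 = u ^ 2 + v ^ 2 + w ^ 2 := by
  simp [EuclideanSpace.norm_sq_eq, Fin.sum_univ_three]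

lemma norm_gradient_fermiDiracMag_sq (β μ b : ℝ) (x ξ : EuclideanSpace ℝ (Fin 3)) :
    ‖gradient (fun x => fermiDiracMag β μ (Amag b) x ξ) x‖ ^ 2 =
      4 * (fermiDerivSq β μ (‖ξ - Amag b x‖ ^ 2 + ‖x‖ ^ 2) *
        ((x 0 - b * (ξ - Amag b x) 1) ^ 2 + (x 1 + b * (ξ - Amag b x) 0) ^ 2 + x 2 ^ 2)) := by
  have h := (hasDerivAt_fermiProfile β μ (‖ξ - Amag b x‖ ^ 2 + ‖x‖ ^ 2)).comp_hasFDerivAt x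
    (hasGradientAt_magneticEnergy b x ξ).hasFDerivAt
  rw [← map_smul] at h
  have hg := (hasGradientAt_iff_hasFDerivAt.2 h).gradient
  rw [show (fun x => fermiDiracMag β μ (Amag b) x ξ) =
    (fun r : ℝ => (1 + Real.exp (β * (r - μ)))⁻¹) ∘
      fun x => ‖ξ - Amag b x‖ ^ 2 + ‖x‖ ^ 2 from rfl, hg, norm_smul, norm_smul, mul_pow, mul_pow, norm_sq_vec]
  simp only [fermiDerivSq, Real.norm_eq_abs, sq_abs]
  ring

lemma Amag_zero : Amag 0 = fun _ => 0 := by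
  funext x
  ext i
  fin_cases i <;> simp [Amag]

lemma continuous_Amag (b : ℝ) : Continuous (Amag b) := by
  refine (PiLp.continuous_toLp 2 _).comp (continuous_pi fun i => ?_)
  fin_cases i <;> simp <;> fun_prop

lemma integral_shear {V : Type*} [NormedAddCommGroup V] [InnerProductSpace ℝ V]
    [FiniteDimensional ℝ V] [MeasurableSpace V] [BorelSpace V] {A : V → V} (hA : Continuous A)
    (g : V × V → ℝ) : (∫ z : V × V, g (z.1, z.2 - A z.1)) = ∫ z, g z := by
  let e : V × V ≃ₜ V × V :=
    { toFun := fun z => (z.1, z.2 - A z.1)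
      invFun := fun z => (z.1, z.2 + A z.1)
      left_inv := fun z => by simp
      right_inv := fun z => by simp
      continuous_toFun := by fun_prop
      continuous_invFun := by fun_prop }
  have hmp : MeasurePreserving e (volume : Measure (V × V)) volume :=
    (MeasurePreserving.id volume).skew_product (g := fun x y => y - A x)
      (by fun_prop) (Filter.Eventually.of_forall fun x => map_sub_right_eq_self volume (A x))
  exact hmp.integral_comp e.measurableEmbedding g

/-- The weight `F'(|z|²)²` on phase space. -/
noncomputable def phaseWeight (β μ : ℝ)
    (z : EuclideanSpace ℝ (Fin 3) × EuclideanSpace ℝ (Fin 3)) : ℝ :=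
  fermiDerivSq β μ (‖z.2‖ ^ 2 + ‖z.1‖ ^ 2)

lemma continuous_phaseWeight (β μ : ℝ) : Continuous (phaseWeight β μ) :=
  (continuous_fermiDerivSq β μ).comp (by fun_prop)

lemma integrable_exp_neg_norm_sq {β : ℝ} (hβ : 0 < β) :
    Integrable fun z : EuclideanSpace ℝ (Fin 3) × EuclideanSpace ℝ (Fin 3) =>
      Real.exp (-(β * (‖z.2‖ ^ 2 + ‖z.1‖ ^ 2))) := by
  have h : Integrable fun v : EuclideanSpace ℝ (Fin 3) => Real.exp (-β * ‖v‖ ^ 2) := by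
    have := (GaussianFourier.integrable_cexp_neg_mul_sq_norm_add (b := (β : ℂ))
      (by simpa using hβ) 0 (0 : EuclideanSpace ℝ (Fin 3))).norm
    refine this.congr (Filter.Eventually.of_forall fun v => ?_)
    simp [Complex.norm_exp, ← Complex.ofReal_pow]
  refine (h.mul_prod h).congr (Filter.Eventually.of_forall fun z => ?_)
  simp only [← Real.exp_add]
  congr 1
  ring

lemma integrable_phaseWeight_mul {β : ℝ} (hβ : 0 < β) (μ : ℝ)
    {p : EuclideanSpace ℝ (Fin 3) × EuclideanSpace ℝ (Fin 3) → ℝ} (hp : Continuous p)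
    (hle : ∀ z, |p z| ≤ ‖z.2‖ ^ 2 + ‖z.1‖ ^ 2) :
    Integrable fun z => phaseWeight β μ z * p z := by
  refine ((integrable_exp_neg_norm_sq hβ).const_mul
    (β * Real.exp (2 * β * μ))).mono'
    ((continuous_phaseWeight β μ).mul hp).aestronglyMeasurable
    (Filter.Eventually.of_forall fun z => ?_)
  set r := ‖z.2‖ ^ 2 + ‖z.1‖ ^ 2 with hr
  have h1 : phaseWeight β μ z ≤ _ := fermiDerivSq_le β μ r
  have h0 : 0 ≤ phaseWeight β μ z := fermiDerivSq_nonneg β μ r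
  have h2 : β * r ≤ Real.exp (β * r) := by linarith [Real.add_one_le_exp (β * r)]
  have hsplit : Real.exp (-(2 * β * r)) * Real.exp (β * r) = Real.exp (-(β * r)) := by
    rw [← Real.exp_add]
    congr 1
    ring
  rw [Real.norm_eq_abs, abs_mul, abs_of_nonneg h0]
  calc phaseWeight β μ z * |p z|
      ≤ (β ^ 2 * Real.exp (2 * β * μ) * Real.exp (-(2 * β * r))) * r := by
        gcongr
        exact hle z
    _ = β * Real.exp (2 * β * μ) * (Real.exp (-(2 * β * r)) * (β * r)) := by ring
    _ ≤ β * Real.exp (2 * β * μ) * (Real.exp (-(2 * β * r)) * Real.exp (β * r)) := by gcongr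
    _ = _ := by rw [hsplit]

lemma sq_apply_le_norm_sq (x : EuclideanSpace ℝ (Fin 3)) (i : Fin 3) : x i ^ 2 ≤ ‖x‖ ^ 2 :=
  sq_le_sq.2 (by simpa using PiLp.norm_apply_le x i)

lemma integrable_phaseWeight_fst_sq {β : ℝ} (hβ : 0 < β) (μ : ℝ) (i : Fin 3) :
    Integrable fun z => phaseWeight β μ z * z.1 i ^ 2 :=
  integrable_phaseWeight_mul hβ μ (by fun_prop) fun z => by
    rw [abs_of_nonneg (sq_nonneg _)]
    nlinarith [sq_apply_le_norm_sq z.1 i, sq_nonneg ‖z.2‖]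

lemma integrable_phaseWeight_snd_sq {β : ℝ} (hβ : 0 < β) (μ : ℝ) (i : Fin 3) :
    Integrable fun z => phaseWeight β μ z * z.2 i ^ 2 :=
  integrable_phaseWeight_mul hβ μ (by fun_prop) fun z => by
    rw [abs_of_nonneg (sq_nonneg _)]
    nlinarith [sq_apply_le_norm_sq z.2 i, sq_nonneg ‖z.1‖]

lemma integrable_phaseWeight_cross {β : ℝ} (hβ : 0 < β) (μ : ℝ) (i j : Fin 3) :
    Integrable fun z => phaseWeight β μ z * (z.1 i * z.2 j) :=
  integrable_phaseWeight_mul hβ μ (by fun_prop) fun z => by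
    have := sq_apply_le_norm_sq z.1 i
    have := sq_apply_le_norm_sq z.2 j
    rw [abs_le]
    constructor <;> nlinarith [sq_nonneg (z.1 i + z.2 j), sq_nonneg (z.1 i - z.2 j)]

lemma integral_comp_swap (g : EuclideanSpace ℝ (Fin 3) × EuclideanSpace ℝ (Fin 3) → ℝ) :
    (∫ z : EuclideanSpace ℝ (Fin 3) × EuclideanSpace ℝ (Fin 3), g z.swap) = ∫ z, g z :=
  integral_prod_swap g

lemma phaseWeight_swap (β μ : ℝ) (z : EuclideanSpace ℝ (Fin 3) × EuclideanSpace ℝ (Fin 3)) :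
    phaseWeight β μ z.swap = phaseWeight β μ z := by
  simp [phaseWeight, add_comm]

lemma integral_comp_isometry_fst
    (e : EuclideanSpace ℝ (Fin 3) ≃ₗᵢ[ℝ] EuclideanSpace ℝ (Fin 3))
    (g : EuclideanSpace ℝ (Fin 3) × EuclideanSpace ℝ (Fin 3) → ℝ) :
    (∫ z : EuclideanSpace ℝ (Fin 3) × EuclideanSpace ℝ (Fin 3), g (e z.1, z.2)) = ∫ z, g z :=
  (e.measurePreserving.prod (MeasurePreserving.id volume)).integral_comp
    (e.toHomeomorph.prodCongr (Homeomorph.refl _)).measurableEmbedding g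

lemma integral_phaseWeight_fst_sq (β μ : ℝ) (i j : Fin 3) :
    (∫ z, phaseWeight β μ z * z.1 i ^ 2) = ∫ z, phaseWeight β μ z * z.1 j ^ 2 := by
  rw [← integral_comp_isometry_fst
    (LinearIsometryEquiv.piLpCongrLeft 2 ℝ ℝ (Equiv.swap i j))]
  simp [phaseWeight, LinearIsometryEquiv.piLpCongrLeft_apply, Equiv.piCongrLeft']

lemma integral_phaseWeight_snd_sq (β μ : ℝ) (i : Fin 3) :
    (∫ z, phaseWeight β μ z * z.2 i ^ 2) = ∫ z, phaseWeight β μ z * z.1 i ^ 2 := by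
  rw [← integral_comp_swap]
  simp only [phaseWeight_swap, Prod.snd_swap]

lemma integral_phaseWeight_cross (β μ : ℝ) (i j : Fin 3) :
    (∫ z, phaseWeight β μ z * (z.1 i * z.2 j)) = 0 := by
  have h := integral_comp_isometry_fst (LinearIsometryEquiv.neg ℝ)
    fun z => phaseWeight β μ z * (z.1 i * z.2 j)
  simp only [phaseWeight, LinearIsometryEquiv.coe_neg, norm_neg, PiLp.neg_apply, neg_mul,
    mul_neg, integral_neg] at h
  simp only [phaseWeight]
  linarith

/-- The squared norm of the `x`-gradient of `f^A`, as a function of `w = (x, ξ − A(x))`. -/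
noncomputable def gradDensity (β μ b : ℝ)
    (w : EuclideanSpace ℝ (Fin 3) × EuclideanSpace ℝ (Fin 3)) : ℝ :=
  4 * (phaseWeight β μ w *
    ((w.1 0 - b * w.2 1) ^ 2 + (w.1 1 + b * w.2 0) ^ 2 + w.1 2 ^ 2))

lemma norm_gradient_fermiDiracMag_sq_eq_gradDensity (β μ b : ℝ)
    (z : EuclideanSpace ℝ (Fin 3) × EuclideanSpace ℝ (Fin 3)) :
    ‖gradient (fun x => fermiDiracMag β μ (Amag b) x z.2) z.1‖ ^ 2 =
      gradDensity β μ b (z.1, z.2 - Amag b z.1) :=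
  norm_gradient_fermiDiracMag_sq β μ b z.1 z.2

lemma gradDensity_expand (β μ b : ℝ)
    (w : EuclideanSpace ℝ (Fin 3) × EuclideanSpace ℝ (Fin 3)) :
    gradDensity β μ b w =
      4 * (phaseWeight β μ w * w.1 0 ^ 2) + 4 * (phaseWeight β μ w * w.1 1 ^ 2) +
      4 * (phaseWeight β μ w * w.1 2 ^ 2) + 4 * b ^ 2 * (phaseWeight β μ w * w.2 0 ^ 2) +
      4 * b ^ 2 * (phaseWeight β μ w * w.2 1 ^ 2) +
      8 * b * (phaseWeight β μ w * (w.1 1 * w.2 0)) +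
      -(8 * b) * (phaseWeight β μ w * (w.1 0 * w.2 1)) := by
  rw [gradDensity]
  ring

lemma integrable_gradDensity {β : ℝ} (hβ : 0 < β) (μ b : ℝ) :
    Integrable (gradDensity β μ b) := by
  have hx := integrable_phaseWeight_fst_sq hβ μ
  have hξ := integrable_phaseWeight_snd_sq hβ μ
  have hc := integrable_phaseWeight_cross hβ μ
  simp only [funext (gradDensity_expand β μ b)]
  exact (((((((hx 0).const_mul _).add ((hx 1).const_mul _)).add ((hx 2).const_mul _)).add
    ((hξ 0).const_mul _)).add ((hξ 1).const_mul _)).add ((hc 1 0).const_mul _)).add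
    ((hc 0 1).const_mul _)

lemma integral_gradDensity {β : ℝ} (hβ : 0 < β) (μ b : ℝ) :
    (∫ w, gradDensity β μ b w) =
      4 * (3 + 2 * b ^ 2) * ∫ w, phaseWeight β μ w * w.1 0 ^ 2 := by
  have hx := integrable_phaseWeight_fst_sq hβ μ
  have hξ := integrable_phaseWeight_snd_sq hβ μ
  have hc := integrable_phaseWeight_cross hβ μ
  simp only [gradDensity_expand]
  have i1 := ((hx 0).const_mul 4).fun_add ((hx 1).const_mul 4)
  have i2 := i1.fun_add ((hx 2).const_mul 4)
  have i3 := i2.fun_add ((hξ 0).const_mul (4 * b ^ 2))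
  have i4 := i3.fun_add ((hξ 1).const_mul (4 * b ^ 2))
  have i5 := i4.fun_add ((hc 1 0).const_mul (8 * b))
  rw [integral_add i5 ((hc 0 1).const_mul _), integral_add i4 ((hc 1 0).const_mul _),
    integral_add i3 ((hξ 1).const_mul _), integral_add i2 ((hξ 0).const_mul _),
    integral_add i1 ((hx 2).const_mul _), integral_add ((hx 0).const_mul _) ((hx 1).const_mul _)]
  simp only [integral_const_mul, integral_phaseWeight_cross, integral_phaseWeight_snd_sq]
  rw [integral_phaseWeight_fst_sq β μ 1 0, integral_phaseWeight_fst_sq β μ 2 0]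
  ring

theorem stmt_17 (β μ b : ℝ) (hβ : 0 < β) (hb : 0 ≤ b) :
    (∫ z : EuclideanSpace ℝ (Fin 3) × EuclideanSpace ℝ (Fin 3),
        ‖gradient (fun x => fermiDiracMag β μ (Amag b) x z.2) z.1‖ ^ 2) =
      (3 + 2 * b ^ 2) / 6 *
        ∫ z : EuclideanSpace ℝ (Fin 3) × EuclideanSpace ℝ (Fin 3),
          (‖gradient (fun x => fermiDiracMag β μ (fun _ => 0) x z.2) z.1‖ ^ 2 +
            ‖gradient (fun ξ => fermiDiracMag β μ (fun _ => 0) z.1 ξ) z.2‖ ^ 2) := by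
  have hswap : ∀ x ξ, fermiDiracMag β μ (fun _ => 0) x ξ =
      fermiDiracMag β μ (fun _ => 0) ξ x := fun x ξ => by
    simp [fermiDiracMag, add_comm]
  have hx : ∀ z : EuclideanSpace ℝ (Fin 3) × EuclideanSpace ℝ (Fin 3),
      ‖gradient (fun x => fermiDiracMag β μ (fun _ => 0) x z.2) z.1‖ ^ 2 =
        gradDensity β μ 0 z := fun z => by
    rw [← Amag_zero, norm_gradient_fermiDiracMag_sq_eq_gradDensity]
    simp [Amag_zero]
  have hξ : ∀ z : EuclideanSpace ℝ (Fin 3) × EuclideanSpace ℝ (Fin 3),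
      ‖gradient (fun ξ => fermiDiracMag β μ (fun _ => 0) z.1 ξ) z.2‖ ^ 2 =
        gradDensity β μ 0 z.swap := fun z => by
    simp only [hswap z.1]
    exact hx z.swap
  have hint := integrable_gradDensity hβ μ 0
  have hint_swap : Integrable fun z : EuclideanSpace ℝ (Fin 3) × EuclideanSpace ℝ (Fin 3) =>
      gradDensity β μ 0 z.swap := hint.swap
  simp only [norm_gradient_fermiDiracMag_sq_eq_gradDensity]
  rw [integral_shear (continuous_Amag b) (gradDensity β μ b), integral_gradDensity hβ]
  simp only [hx, hξ]
  rw [integral_add hint hint_swap, integral_comp_swap (gradDensity β μ 0),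
    integral_gradDensity hβ]
  ring
end
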